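/- There exist finite monotonic neighbourhood frames F₁ = ⟨W₁, N₁⟩ and F₂ = ⟨W₂, N₂⟩ and a surjective bounded core morphism f : F₁ → F₂ such that the non-monotonic core of N₁ at every point is a pairwise disjoint family (so F₁ belongs to the class P of frames whose non-monotonic cores are partitions of the domain) while the non-monotonic core of N₂ at some point contains two distinct overlapping sets (so F₂ ∉ P). Concretely: W₁ = {w₁,w₂,w₃,w₄}, with core N₁↓(w₁) = {{w₁,w₂},{w₃,w₄}} and N₁↓(w) = {W₁} for w ∈ {w₂,w₃,w₄}; W₂ = {v₁,v₂,v₃}, with core N₂↓(v₁) = {{v₁,v₂},{v₂,v₃}} and N₂↓(v) = {W₂} for v ∈ {v₂,v₃}; N₁(w) and N₂(v) are the superset closures of these cores; and f maps w₁ ↦ v₁, w₂ ↦ v₂, w₃ ↦ v₃, w₄ ↦ v₂. Consequently, the class P is not closed under bounded core morphic images. -/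

import Mathlib

/-- Non-monotonic core of a neighbourhood function at a point. -/
def core {W : Type} (N : W → Set (Set W)) (w : W) : Set (Set W) :=
  {X | X ∈ N w ∧ ¬ ∃ Y ∈ N w, Y ⊂ X}

/-- A monotonic (superset-closed) neighbourhood function. -/
def Monotonic {W : Type} (N : W → Set (Set W)) : Prop :=
  ∀ (w : W) (X Y : Set W), X ⊆ Y → X ∈ N w → Y ∈ N w

/-- The core of N at every point is a partition-like pairwise disjoint family. -/
def CoreDisjoint {W : Type} (N : W → Set (Set W)) : Prop :=
  ∀ (w : W) (X Y : Set W), X ∈ core N w → Y ∈ core N w → X ≠ Y → X ∩ Y = ∅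

/-- f is a bounded core morphism between monotonic neighbourhood frames. -/
def BoundedCoreMorphism {W₁ W₂ : Type} (N₁ : W₁ → Set (Set W₁))
    (N₂ : W₂ → Set (Set W₂)) (f : W₁ → W₂) : Prop :=
  (∀ (w : W₁) (X : Set W₁), X ∈ core N₁ w → f '' X ∈ core N₂ (f w)) ∧
  (∀ (w : W₁) (Y : Set W₂), Y ∈ core N₂ (f w) →
    ∃ X : Set W₁, f '' X = Y ∧ X ∈ core N₁ w)

/-- The neighbourhood function whose neighbourhoods are the supersets of members of `C w`. -/
def supersetClosure {W : Type} (C : W → Set (Set W)) (w : W) : Set (Set W) :=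
  {X | ∃ Y ∈ C w, Y ⊆ X}

theorem monotonic_supersetClosure {W : Type} (C : W → Set (Set W)) :
    Monotonic (supersetClosure C) := by
  rintro w X Y hXY ⟨Z, hZ, hZX⟩
  exact ⟨Z, hZ, hZX.trans hXY⟩

theorem core_supersetClosure {W : Type} {C : W → Set (Set W)} {w : W}
    (h : IsAntichain (· ⊆ ·) (C w)) : core (supersetClosure C) w = C w := by
  ext X
  constructor
  · rintro ⟨⟨Y, hY, hYX⟩, hmin⟩
    rcases hYX.eq_or_ssubset with rfl | hss
    · exact hY
    · exact absurd ⟨Y, ⟨Y, hY, subset_rfl⟩, hss⟩ hmin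
  · intro hX
    refine ⟨⟨X, hX, subset_rfl⟩, ?_⟩
    rintro ⟨Y, ⟨Z, hZ, hZY⟩, hYX⟩
    have hZX : Z = X := h.eq hZ hX (hZY.trans hYX.subset)
    exact hYX.not_subset (hZX ▸ hZY)

/-- The core of the partition frame on four points. -/
def partitionCore (w : Fin 4) : Set (Set (Fin 4)) :=
  if w = 0 then {{0, 1}, {2, 3}} else {Set.univ}

/-- The core of the frame on three points with overlapping core sets. -/
def overlapCore (v : Fin 3) : Set (Set (Fin 3)) :=
  if v = 0 then {{0, 1}, {1, 2}} else {Set.univ}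

theorem core_partitionCore (w : Fin 4) :
    core (supersetClosure partitionCore) w = partitionCore w := by
  apply core_supersetClosure
  unfold partitionCore
  split_ifs
  · rintro X (rfl | rfl) Y (rfl | rfl) hne <;> simp_all [Set.insert_subset_iff]
  · exact IsAntichain.singleton

theorem core_overlapCore (v : Fin 3) :
    core (supersetClosure overlapCore) v = overlapCore v := by
  apply core_supersetClosure
  unfold overlapCore
  split_ifs
  · rintro X (rfl | rfl) Y (rfl | rfl) hne <;> simp_all [Set.insert_subset_iff]
  · exact IsAntichain.singleton

/-- The map identifying the second and the fourth point. -/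
def foldMap : Fin 4 → Fin 3 := ![0, 1, 2, 1]

theorem foldMap_surjective : Function.Surjective foldMap := by
  unfold foldMap
  decide

theorem foldMap_eq_zero_iff (w : Fin 4) : foldMap w = 0 ↔ w = 0 := by
  revert w
  unfold foldMap
  decide

theorem image_foldMap_partitionCore (w : Fin 4) :
    Set.image (Set.image foldMap) (partitionCore w) = overlapCore (foldMap w) := by
  unfold partitionCore overlapCore
  simp only [foldMap_eq_zero_iff]
  split_ifs
  · simp [Set.image_pair, foldMap, Set.pair_comm]
  · simp [foldMap_surjective.range_eq]

/-- there are finite monotonic neighbourhood frames F₁ = ⟨Fin 4, N₁⟩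
(whose cores are pairwise disjoint — F₁ ∈ P) and F₂ = ⟨Fin 3, N₂⟩ (whose core at
some point contains two distinct overlapping sets — F₂ ∉ P) and a surjective
bounded core morphism f : F₁ → F₂, with the concrete data
N₁↓(w₁) = {{w₁,w₂},{w₃,w₄}}, N₁↓(w) = {W₁} otherwise;
N₂↓(v₁) = {{v₁,v₂},{v₂,v₃}}, N₂↓(v) = {W₂} otherwise;
N₁, N₂ the superset closures of these cores; f : w₁↦v₁, w₂↦v₂, w₃↦v₃, w₄↦v₂.
Hence the class P is not closed under bounded core morphic images. -/
theorem stmt9 :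
    ∃ (N₁ : Fin 4 → Set (Set (Fin 4))) (N₂ : Fin 3 → Set (Set (Fin 3)))
      (f : Fin 4 → Fin 3),
      Monotonic N₁ ∧ Monotonic N₂ ∧
      -- N₁ and N₂ are the superset closures of their cores
      (∀ w X, X ∈ N₁ w ↔ ∃ Y ∈ core N₁ w, Y ⊆ X) ∧
      (∀ v Y, Y ∈ N₂ v ↔ ∃ X ∈ core N₂ v, X ⊆ Y) ∧
      -- the concrete cores
      core N₁ 0 = {{0, 1}, {2, 3}} ∧
      (∀ w : Fin 4, w ≠ 0 → core N₁ w = {Set.univ}) ∧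
      core N₂ 0 = {{0, 1}, {1, 2}} ∧
      (∀ v : Fin 3, v ≠ 0 → core N₂ v = {Set.univ}) ∧
      -- the concrete map
      f 0 = 0 ∧ f 1 = 1 ∧ f 2 = 2 ∧ f 3 = 1 ∧
      -- f is a surjective bounded core morphism
      Function.Surjective f ∧
      BoundedCoreMorphism N₁ N₂ f ∧
      -- F₁ ∈ P : cores pairwise disjoint (and they never contain ∅ and cover W₁)
      CoreDisjoint N₁ ∧
      (∀ w, ∅ ∉ core N₁ w ∧ ⋃₀ core N₁ w = Set.univ) ∧
      -- F₂ ∉ P : two distinct overlapping core members at some point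
      (∃ (v : Fin 3) (X Y : Set (Fin 3)),
        X ∈ core N₂ v ∧ Y ∈ core N₂ v ∧ X ≠ Y ∧ (X ∩ Y).Nonempty) := by
  refine ⟨supersetClosure partitionCore, supersetClosure overlapCore, foldMap,
    monotonic_supersetClosure _, monotonic_supersetClosure _, ?_, ?_, ?_, ?_, ?_, ?_,
    rfl, rfl, rfl, rfl, foldMap_surjective, ⟨?_, ?_⟩, ?_, ?_, ?_⟩
  · intro w X
    rw [core_partitionCore]
    rfl
  · intro v Y
    rw [core_overlapCore]
    rfl
  · simp [core_partitionCore, partitionCore]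
  · intro w hw
    simp [core_partitionCore, partitionCore, hw]
  · simp [core_overlapCore, overlapCore]
  · intro v hv
    simp [core_overlapCore, overlapCore, hv]
  · intro w X hX
    rw [core_partitionCore] at hX
    rw [core_overlapCore, ← image_foldMap_partitionCore]
    exact Set.mem_image_of_mem _ hX
  · intro w Y hY
    rw [core_overlapCore, ← image_foldMap_partitionCore] at hY
    obtain ⟨X, hX, rfl⟩ := hY
    exact ⟨X, rfl, by rwa [core_partitionCore]⟩
  · intro w X Y hX hY hne
    rw [core_partitionCore, partitionCore] at hX hY
    split_ifs at hX hY
    · rcases hX with rfl | rfl <;> rcases hY with rfl | rfl <;>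
        first | exact absurd rfl hne | (ext x; fin_cases x <;> simp)
    · exact absurd (hX.trans hY.symm) hne
  · intro w
    rw [core_partitionCore, partitionCore]
    split_ifs
    · constructor
      · rintro (h | h)
        · exact (Set.insert_nonempty _ _).ne_empty h.symm
        · exact (Set.insert_nonempty _ _).ne_empty h.symm
      · ext x
        fin_cases x <;> simp
    · simp [Set.empty_ne_univ]
  · refine ⟨0, {0, 1}, {1, 2}, ?_, ?_, ?_, 1, ?_⟩
    · simp [core_overlapCore, overlapCore]
    · simp [core_overlapCore, overlapCore]
    · intro h
      have h0 : (0 : Fin 3) ∈ ({1, 2} : Set (Fin 3)) := h ▸ Set.mem_insert _ _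
      simp at h0
    · simp
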